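/- N(Γ(3)) = 5: the set of cosets P·SL₂(ℤ) in SL₂(ℝ)/SL₂(ℤ) such that P⁻¹·A·P has integer entries for every A ∈ Γ(3) has exactly 5 elements. -/

import Mathlib

open Matrix MatrixGroups CongruenceSubgroup

/-- A real 2×2 matrix has integer entries. -/
def IsIntegerMatrix (M : Matrix (Fin 2) (Fin 2) ℝ) : Prop :=
  ∀ i j, ∃ k : ℤ, M i j = (k : ℝ)

/-- The embedding `SL(2, ℤ) →* SL(2, ℝ)`. -/
noncomputable def toSL2R : SL(2, ℤ) →* SL(2, ℝ) :=
  Matrix.SpecialLinearGroup.map (Int.castRingHom ℝ)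

/-- `SL(2, ℤ)` as a subgroup of `SL(2, ℝ)`. -/
noncomputable def SL2ZinR : Subgroup SL(2, ℝ) := toSL2R.range

/-- The set of cosets `P·SL₂(ℤ)` in `SL₂(ℝ)/SL₂(ℤ)` such that `P⁻¹·A·P` has integer
entries for every `A ∈ G`; its cardinality is `N(G)`. -/
noncomputable def goodCosets (G : Subgroup SL(2, ℤ)) : Set (SL(2, ℝ) ⧸ SL2ZinR) :=
  {x | ∃ P : SL(2, ℝ), x = QuotientGroup.mk P ∧ ∀ A ∈ G,
    IsIntegerMatrix ((P⁻¹ * toSL2R A * P : SL(2, ℝ)) : Matrix (Fin 2) (Fin 2) ℝ)}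

/-- If all the products `n * v i * v j` are integers, then the `v i` are integer multiples of a
single real number `g` such that `n * g ^ 2` is an integer. -/
theorem exists_common_divisor_of_mul_mem_range_intCast {ι : Type*} {n : ℕ} (hn : 0 < n)
    (v : ι → ℝ) (hv : ∀ i j, n * (v i * v j) ∈ (Int.castRingHom ℝ).range) :
    ∃ (g : ℝ) (t : ℤ) (w : ι → ℤ), n * (g * g) = t ∧ ∀ i, v i = w i * g := by
  have key : ∀ x ∈ AddSubgroup.closure (Set.range v), ∀ y ∈ AddSubgroup.closure (Set.range v),
      n * (x * y) ∈ (Int.castRingHom ℝ).range := by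
    intro x hx y hy
    induction hx, hy using AddSubgroup.closure_induction₂ with
    | mem x y hx hy =>
      obtain ⟨i, rfl⟩ := hx
      obtain ⟨j, rfl⟩ := hy
      exact hv i j
    | zero_left x hx => simp
    | zero_right x hx => simp
    | add_left x y z _ _ _ h₁ h₂ => simpa only [add_mul, mul_add] using add_mem h₁ h₂
    | add_right x y z _ _ _ h₁ h₂ => simpa only [add_mul, mul_add] using add_mem h₁ h₂
    | neg_left x y _ _ h => simpa only [neg_mul, mul_neg] using neg_mem h
    | neg_right x y _ _ h => simpa only [neg_mul, mul_neg] using neg_mem h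
  have hn' : (0 : ℝ) < n := by exact_mod_cast hn
  have hn₁ : (1 : ℝ) ≤ n := by exact_mod_cast hn
  have isolated : Disjoint (AddSubgroup.closure (Set.range v) : Set ℝ) (Set.Ioo 0 (n : ℝ)⁻¹) := by
    rw [Set.disjoint_left]
    rintro x hx ⟨hx₀, hx₁⟩
    obtain ⟨k, hk⟩ := key x hx x hx
    simp only [eq_intCast] at hk
    have hnx : n * x < 1 := by
      calc n * x < n * (n : ℝ)⁻¹ := by gcongr
        _ = 1 := mul_inv_cancel₀ hn'.ne'
    have hx₂ : x < 1 := by nlinarith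
    have h₀ : (0 : ℝ) < k := by rw [hk]; positivity
    have h₁ : (k : ℝ) < 1 := by rw [hk]; nlinarith
    norm_cast at h₀ h₁
    omega
  obtain ⟨g, hg⟩ := AddSubgroup.cyclic_of_isolated_zero (inv_pos.mpr hn') isolated
  have hgm : g ∈ AddSubgroup.closure (Set.range v) := by
    rw [hg]; exact AddSubgroup.mem_closure_singleton_self g
  obtain ⟨t, ht⟩ := key g hgm g hgm
  have hw : ∀ i, ∃ k : ℤ, v i = k * g := by
    intro i
    have hi : v i ∈ AddSubgroup.closure (Set.range v) :=
      AddSubgroup.subset_closure (Set.mem_range_self i)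
    rw [hg, AddSubgroup.mem_closure_singleton] at hi
    obtain ⟨k, hk⟩ := hi
    exact ⟨k, by rw [← hk, zsmul_eq_mul]⟩
  choose w hw using hw
  exact ⟨g, t, w, by simpa using ht.symm, hw⟩

theorem toSL2R_apply (A : SL(2, ℤ)) (i j : Fin 2) : toSL2R A i j = (A i j : ℝ) := rfl

theorem mem_SL2ZinR_iff (P : SL(2, ℝ)) :
    P ∈ SL2ZinR ↔ IsIntegerMatrix (P : Matrix (Fin 2) (Fin 2) ℝ) := by
  constructor
  · rintro ⟨A, rfl⟩ i j
    exact ⟨A i j, toSL2R_apply A i j⟩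
  · intro h
    choose k hk using h
    have hdet : (Matrix.of k).det = 1 := by
      have := P.det_coe
      rw [Matrix.det_fin_two] at this ⊢
      simp only [hk] at this
      exact_mod_cast this
    refine ⟨⟨Matrix.of k, hdet⟩, ?_⟩
    ext i j
    exact (hk i j).symm

/-- The real matrix of determinant one proportional to an integer matrix of determinant three. -/
noncomputable def normalizeDetThree (M : Matrix (Fin 2) (Fin 2) ℤ) (hM : M.det = 3) : SL(2, ℝ) :=
  ⟨(√3)⁻¹ • M.map (fun k : ℤ => (k : ℝ)), by
    have h : ((M 0 0 : ℝ) * M 1 1 - M 0 1 * M 1 0) = 3 := by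
      rw [Matrix.det_fin_two] at hM
      exact_mod_cast hM
    have h₃ : (√3)⁻¹ * (√3)⁻¹ * 3 = (1 : ℝ) := by
      rw [← mul_inv, Real.mul_self_sqrt (by norm_num)]; norm_num
    rw [Matrix.det_fin_two]
    simp only [Matrix.smul_apply, Matrix.map_apply, smul_eq_mul]
    linear_combination ((√3)⁻¹ * (√3)⁻¹) * h + h₃⟩

theorem normalizeDetThree_apply (M : Matrix (Fin 2) (Fin 2) ℤ) (hM : M.det = 3) (i j : Fin 2) :
    normalizeDetThree M hM i j = (√3)⁻¹ * M i j := rfl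

theorem isIntegerMatrix_normalizeDetThree_inv_mul_mul (M N : Matrix (Fin 2) (Fin 2) ℤ)
    (hM : M.det = 3) (hN : N.det = 3) (B : SL(2, ℤ)) :
    IsIntegerMatrix (((normalizeDetThree M hM)⁻¹ * toSL2R B * normalizeDetThree N hN :
      SL(2, ℝ)) : Matrix (Fin 2) (Fin 2) ℝ) ↔
      ∀ i j, 3 ∣ (M.adjugate * (B : Matrix (Fin 2) (Fin 2) ℤ) * N) i j := by
  have h₃ : (√3)⁻¹ * (√3)⁻¹ = (1 / 3 : ℝ) := by
    rw [← mul_inv, Real.mul_self_sqrt (by norm_num)]; norm_num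
  have entry : ∀ i j, ((normalizeDetThree M hM)⁻¹ * toSL2R B * normalizeDetThree N hN :
      SL(2, ℝ)) i j = (√3)⁻¹ * (√3)⁻¹ *
      ((M.adjugate * (B : Matrix (Fin 2) (Fin 2) ℤ) * N) i j : ℤ) := by
    intro i j
    simp only [Matrix.SpecialLinearGroup.coe_mul, Matrix.SpecialLinearGroup.coe_inv,
      Matrix.mul_apply, Fin.sum_univ_two, Matrix.adjugate_fin_two, normalizeDetThree_apply,
      toSL2R_apply]
    fin_cases i <;> fin_cases j <;> simp <;> ring
  refine forall_congr' fun i => forall_congr' fun j => ?_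
  rw [entry, h₃]
  refine exists_congr fun k => ?_
  rw [one_div, inv_mul_eq_iff_eq_mul₀ (by norm_num)]
  norm_cast

/-- Representatives, up to right multiplication by `SL(2, ℤ)`, of the integer matrices of
determinant three. -/
def heckeRep : Option (Fin 3) → Matrix (Fin 2) (Fin 2) ℤ
  | none => !![3, 0; 0, 1]
  | some k => !![1, 0; (k : ℕ), 3]

theorem det_heckeRep (x : Option (Fin 3)) : (heckeRep x).det = 3 := by
  cases x <;> simp [heckeRep, Matrix.det_fin_two]

theorem exists_dvd_adjugate_heckeRep_mul (W : Matrix (Fin 2) (Fin 2) ℤ) (hW : W.det = 3) :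
    ∃ x, ∀ i j, 3 ∣ ((heckeRep x).adjugate * W) i j := by
  have fin : ∀ a b c d : ZMod 3, a * d - b * c = 0 →
      (a = 0 ∧ b = 0) ∨ ∃ k : Fin 3, c - (k : ℕ) * a = 0 ∧ d - (k : ℕ) * b = 0 := by decide
  have h := congrArg (Int.cast : ℤ → ZMod 3) hW
  rw [Matrix.det_fin_two] at h
  push_cast at h
  rcases fin (W 0 0) (W 0 1) (W 1 0) (W 1 1) (h.trans (by decide)) with ⟨h₀, h₁⟩ | ⟨k, h₀, h₁⟩
  · refine ⟨none, ?_⟩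
    rw [ZMod.intCast_zmod_eq_zero_iff_dvd] at h₀ h₁
    intro i j
    fin_cases i <;> fin_cases j <;>
      simp [heckeRep, Matrix.adjugate_fin_two, Matrix.mul_apply, Fin.sum_univ_two] <;>
      assumption_mod_cast
  · refine ⟨some k, ?_⟩
    have h₀' : (3 : ℤ) ∣ W 1 0 - (k : ℕ) * W 0 0 := by
      refine (ZMod.intCast_zmod_eq_zero_iff_dvd _ 3).mp ?_
      push_cast; exact h₀
    have h₁' : (3 : ℤ) ∣ W 1 1 - (k : ℕ) * W 0 1 := by
      refine (ZMod.intCast_zmod_eq_zero_iff_dvd _ 3).mp ?_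
      push_cast; exact h₁
    intro i j
    fin_cases i <;> fin_cases j <;>
      simp [heckeRep, Matrix.adjugate_fin_two, Matrix.mul_apply, Fin.sum_univ_two] <;>
      omega

theorem eq_of_dvd_adjugate_heckeRep_mul {x y : Option (Fin 3)}
    (h : ∀ i j, 3 ∣ ((heckeRep x).adjugate * heckeRep y) i j) : x = y := by
  revert x y
  decide

/-- Representatives of the cosets counted by `goodCosets (Gamma 3)`. -/
noncomputable def gammaThreeRep : Option (Option (Fin 3)) → SL(2, ℝ)
  | none => 1
  | some x => normalizeDetThree (heckeRep x) (det_heckeRep x)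

theorem normalizeDetThree_heckeRep_notMem (x : Option (Fin 3)) :
    normalizeDetThree (heckeRep x) (det_heckeRep x) ∉ SL2ZinR := by
  rw [mem_SL2ZinR_iff]
  intro h
  have aux : ¬ ∃ k : ℤ, (√3)⁻¹ = (k : ℝ) := by
    rintro ⟨k, hk⟩
    have h₃ : (3 : ℝ) * (k * k) = 1 := by
      rw [← hk, ← mul_inv, Real.mul_self_sqrt (by norm_num)]; norm_num
    norm_cast at h₃
    omega
  cases x with
  | none => exact aux (by simpa [normalizeDetThree_apply, heckeRep] using h 1 1)
  | some k => exact aux (by simpa [normalizeDetThree_apply, heckeRep] using h 0 0)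

theorem mk_gammaThreeRep_injective :
    Function.Injective fun x => (QuotientGroup.mk (gammaThreeRep x) : SL(2, ℝ) ⧸ SL2ZinR) := by
  intro x y hxy
  have h := QuotientGroup.eq.mp hxy
  match x, y with
  | none, none => rfl
  | none, some y =>
    exact absurd (by simpa [gammaThreeRep] using h) (normalizeDetThree_heckeRep_notMem y)
  | some x, none =>
    exact absurd (by simpa [gammaThreeRep] using h) (normalizeDetThree_heckeRep_notMem x)
  | some x, some y =>
    rw [mem_SL2ZinR_iff] at h
    have h' := isIntegerMatrix_normalizeDetThree_inv_mul_mul (heckeRep x) (heckeRep y)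
      (det_heckeRep x) (det_heckeRep y) 1
    rw [map_one, mul_one, Matrix.SpecialLinearGroup.coe_one, mul_one] at h'
    rw [eq_of_dvd_adjugate_heckeRep_mul (h'.mp h)]

theorem mk_normalizeDetThree_mem_goodCosets (M : Matrix (Fin 2) (Fin 2) ℤ) (hM : M.det = 3) :
    (QuotientGroup.mk (normalizeDetThree M hM) : SL(2, ℝ) ⧸ SL2ZinR) ∈ goodCosets (Gamma 3) := by
  refine ⟨_, rfl, fun A hA => ?_⟩
  rw [isIntegerMatrix_normalizeDetThree_inv_mul_mul]
  intro i j
  obtain ⟨h₀₀, h₀₁, h₁₀, h₁₁⟩ := Gamma_mem.mp hA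
  have hM' := congrArg (Int.cast : ℤ → ZMod 3) hM
  rw [Matrix.det_fin_two] at hM'
  push_cast at hM'
  replace hM' := hM'.trans (show (3 : ZMod 3) = 0 by decide)
  refine (ZMod.intCast_zmod_eq_zero_iff_dvd _ 3).mp ?_
  simp only [Matrix.adjugate_fin_two, Matrix.mul_apply, Fin.sum_univ_two]
  push_cast
  rw [h₀₀, h₀₁, h₁₀, h₁₁]
  fin_cases i <;> fin_cases j <;> simp <;>
    first | linear_combination hM' | ring

theorem mul_entries_mem_of_conj_integer {P : SL(2, ℝ)}
    (hP : ∀ A ∈ Gamma 3,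
      IsIntegerMatrix ((P⁻¹ * toSL2R A * P : SL(2, ℝ)) : Matrix (Fin 2) (Fin 2) ℝ))
    (x y : Fin 2 × Fin 2) :
    (3 : ℕ) * (P x.1 x.2 * P y.1 y.2) ∈ (Int.castRingHom ℝ).range := by
  set R := (Int.castRingHom ℝ).range with hR
  have hdet : P 0 0 * P 1 1 - P 0 1 * P 1 0 = 1 := by
    rw [← Matrix.det_fin_two]; exact P.det_coe
  have mem : ∀ A ∈ Gamma 3, ∀ i j, ((P⁻¹ * toSL2R A * P : SL(2, ℝ)) i j : ℝ) ∈ R := by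
    intro A hA i j
    obtain ⟨k, hk⟩ := hP A hA i j
    exact ⟨k, by rw [hk]; rfl⟩
  have conj : ∀ p q r s : ℤ, ∀ h : (!![p, q; r, s]).det = 1,
      ((p : ZMod 3) = 1 ∧ (q : ZMod 3) = 0 ∧ (r : ZMod 3) = 0 ∧ (s : ZMod 3) = 1) →
      P 1 1 * (p * P 0 0 + q * P 1 0) - P 0 1 * (r * P 0 0 + s * P 1 0) ∈ R ∧
      P 1 1 * (p * P 0 1 + q * P 1 1) - P 0 1 * (r * P 0 1 + s * P 1 1) ∈ R ∧
      -P 1 0 * (p * P 0 0 + q * P 1 0) + P 0 0 * (r * P 0 0 + s * P 1 0) ∈ R := by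
    intro p q r s h hmod
    obtain ⟨A, rfl, rfl, rfl, rfl⟩ :
        ∃ A : SL(2, ℤ), A 0 0 = p ∧ A 0 1 = q ∧ A 1 0 = r ∧ A 1 1 = s :=
      ⟨⟨!![p, q; r, s], h⟩, rfl, rfl, rfl, rfl⟩
    have hA := mem A (Gamma_mem.mpr hmod)
    simp only [Matrix.SpecialLinearGroup.coe_mul, Matrix.SpecialLinearGroup.coe_inv,
      Matrix.mul_apply, Fin.sum_univ_two, Matrix.adjugate_fin_two, toSL2R_apply] at hA
    refine ⟨?_, ?_, ?_⟩
    · convert hA 0 0 using 1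
      simp; ring
    · convert hA 0 1 using 1
      simp; ring
    · convert hA 1 0 using 1
      simp; ring
  obtain ⟨t₀, t₁, t₂⟩ := conj 1 3 0 1 (by simp [Matrix.det_fin_two]) (by decide)
  obtain ⟨u₀, u₁, u₂⟩ := conj 1 0 3 1 (by simp [Matrix.det_fin_two]) (by decide)
  obtain ⟨v₀, v₁, v₂⟩ := conj 4 3 (-3) (-2) (by simp [Matrix.det_fin_two]) (by decide)
  push_cast at t₀ t₁ t₂ u₀ u₁ u₂ v₀ v₁ v₂
  have aa : 3 * (P 0 0 * P 0 0) ∈ R := by convert u₂ using 1; ring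
  have bb : 3 * (P 0 1 * P 0 1) ∈ R := by convert neg_mem u₁ using 1; ring
  have cc : 3 * (P 1 0 * P 1 0) ∈ R := by convert neg_mem t₂ using 1; ring
  have dd : 3 * (P 1 1 * P 1 1) ∈ R := by convert t₁ using 1; ring
  have cd : 3 * (P 1 0 * P 1 1) ∈ R := by
    convert sub_mem t₀ (one_mem R) using 1; linear_combination -hdet
  have ab : 3 * (P 0 0 * P 0 1) ∈ R := by
    convert sub_mem (one_mem R) u₀ using 1; linear_combination hdet
  have bd : 3 * (P 0 1 * P 1 1) ∈ R := by
    convert sub_mem (sub_mem (mul_mem dd ab) (mul_mem cd bb)) (sub_mem (sub_mem v₁ dd) bb) using 1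
    linear_combination (-9 * P 0 1 * P 1 1) * hdet
  have ac : 3 * (P 0 0 * P 1 0) ∈ R := by
    convert add_mem (sub_mem (mul_mem cd aa) (mul_mem cc ab)) (add_mem (add_mem v₂ cc) aa) using 1
    linear_combination (-9 * P 0 0 * P 1 0) * hdet
  have bc : 3 * (P 0 1 * P 1 0) ∈ R := by
    convert add_mem (sub_mem (sub_mem (mul_mem cd ab) (mul_mem bb cc))
      (sub_mem (sub_mem v₀ cd) ab)) (natCast_mem R 4) using 1
    push_cast
    linear_combination (4 - 9 * P 0 1 * P 1 0) * hdet
  have ad : 3 * (P 0 0 * P 1 1) ∈ R := by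
    convert add_mem bc (natCast_mem R 3) using 1
    push_cast
    linear_combination 3 * hdet
  obtain ⟨i, j⟩ := x
  obtain ⟨k, l⟩ := y
  push_cast
  fin_cases i <;> fin_cases j <;> fin_cases k <;> fin_cases l <;>
    first | assumption | (rw [mul_comm (P.1 _ _)]; assumption)

theorem mk_mem_range_of_conj_integer {P : SL(2, ℝ)}
    (hP : ∀ A ∈ Gamma 3,
      IsIntegerMatrix ((P⁻¹ * toSL2R A * P : SL(2, ℝ)) : Matrix (Fin 2) (Fin 2) ℝ)) :
    ∃ x, (QuotientGroup.mk (gammaThreeRep x) : SL(2, ℝ) ⧸ SL2ZinR) = QuotientGroup.mk P := by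
  obtain ⟨g, t, w, ht, hw⟩ := exists_common_divisor_of_mul_mem_range_intCast
    (by norm_num) (fun p : Fin 2 × Fin 2 => P p.1 p.2) (mul_entries_mem_of_conj_integer hP)
  have hdet : P 0 0 * P 1 1 - P 0 1 * P 1 0 = 1 := by
    rw [← Matrix.det_fin_two]; exact P.det_coe
  have hP' : ∀ i j, P i j = w (i, j) * g := fun i j => hw (i, j)
  push_cast at ht
  have htw : t * (w (0, 0) * w (1, 1) - w (0, 1) * w (1, 0)) = 3 := by
    simp only [hP'] at hdet
    have : (t : ℝ) * (w (0, 0) * w (1, 1) - w (0, 1) * w (1, 0)) = 3 := by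
      rw [← ht]; linear_combination 3 * hdet
    exact_mod_cast this
  have ht₀ : 0 ≤ t := by
    have : (0 : ℝ) ≤ t := by rw [← ht]; nlinarith [mul_self_nonneg g]
    exact_mod_cast this
  have ht₃ : t ≤ 3 := Int.le_of_dvd (by norm_num) ⟨_, htw.symm⟩
  have hcases : t = 1 ∨ t = 3 := by
    interval_cases t <;> omega
  rcases hcases with rfl | rfl
  · have hg : g = (√3)⁻¹ ∨ g = -(√3)⁻¹ := by
      rw [← sq_eq_sq_iff_eq_or_eq_neg, inv_pow, Real.sq_sqrt (by norm_num)]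
      push_cast at ht
      linarith
    have hW : ∃ (W : Matrix (Fin 2) (Fin 2) ℤ) (hW : W.det = 3), P = normalizeDetThree W hW := by
      rcases hg with hg | hg
      · refine ⟨Matrix.of fun i j => w (i, j), ?_, ?_⟩
        · rw [Matrix.det_fin_two]; simpa using htw
        · ext i j
          rw [normalizeDetThree_apply, hP', hg, mul_comm]; rfl
      · refine ⟨Matrix.of fun i j => -w (i, j), ?_, ?_⟩
        · rw [Matrix.det_fin_two]; simpa using htw
        · ext i j
          rw [normalizeDetThree_apply, hP', hg]
          simp [mul_comm]
    obtain ⟨W, hW, rfl⟩ := hW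
    obtain ⟨x, hx⟩ := exists_dvd_adjugate_heckeRep_mul W hW
    refine ⟨some x, QuotientGroup.eq.mpr ?_⟩
    rw [mem_SL2ZinR_iff]
    have h := isIntegerMatrix_normalizeDetThree_inv_mul_mul (heckeRep x) W (det_heckeRep x) hW 1
    rw [map_one, mul_one, Matrix.SpecialLinearGroup.coe_one, mul_one] at h
    exact h.mpr hx
  · have hg : g = 1 ∨ g = -1 := by
      rw [← sq_eq_sq_iff_eq_or_eq_neg]
      push_cast at ht
      linarith
    refine ⟨none, QuotientGroup.eq.mpr ?_⟩
    rw [gammaThreeRep, inv_one, one_mul, mem_SL2ZinR_iff]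
    intro i j
    rcases hg with hg | hg
    · exact ⟨w (i, j), by rw [hP', hg, mul_one]⟩
    · exact ⟨-w (i, j), by rw [hP', hg]; push_cast; ring⟩

theorem goodCosets_Gamma_three_eq_range :
    goodCosets (Gamma 3) =
      Set.range fun x => (QuotientGroup.mk (gammaThreeRep x) : SL(2, ℝ) ⧸ SL2ZinR) := by
  ext c
  constructor
  · rintro ⟨P, rfl, hP⟩
    exact mk_mem_range_of_conj_integer hP
  · rintro ⟨x, rfl⟩
    cases x with
    | none =>
      refine ⟨1, rfl, fun A _ => ?_⟩
      rw [inv_one, one_mul, mul_one, ← mem_SL2ZinR_iff]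
      exact ⟨A, rfl⟩
    | some x => exact mk_normalizeDetThree_mem_goodCosets _ (det_heckeRep x)

/-- `N(Γ(3)) = 5`. -/
theorem stmt_16 : (goodCosets (Gamma 3)).ncard = 5 := by
  rw [goodCosets_Gamma_three_eq_range, ← Nat.card_coe_set_eq,
    Nat.card_range_of_injective mk_gammaThreeRep_injective]
  simp
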